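/- arXiv:1709.01418 — 2 statements merged into one kernel-verified Lean document; each statement's English description precedes it below -/
import Mathlib

section
/- Let λ ∈ ℝ \ {−1, 0, 1} and let T ∈ B(H) be self-adjoint with orthogonal decomposition H = ker T ⊕ ker(T − I) ⊕ ker(T − λI) ⊕ ker(T − (1+λ)I) ⊕ (K ⊕ K), where the last summand reduces T and T restricted to K ⊕ K equals (B ⊕ (−B)) + ((1+λ)/2)·I for a positive operator B on K with (|1−|λ||/2)·I < B < ((1+|λ|)/2)·I. Let 𝒯_λ = {(P, Q) : P, Q orthogonal projections on H with T = λP + Q} and let W*(𝒯_λ) be the von Neumann algebra generated by {P : (P,Q) ∈ 𝒯_λ} ∪ {Q : (P,Q) ∈ 𝒯_λ}. Then, relative to the above decomposition, W*(𝒯_λ) = ℂI ⊕ ℂI ⊕ ℂI ⊕ ℂI ⊕ M₂({B}'), where M₂({B}') is the set of operators on K ⊕ K whose four block entries commute with B, and the commutant of W*(𝒯_λ) equals B(ker T) ⊕ B(ker(T − I)) ⊕ B(ker(T − λI)) ⊕ B(ker(T − (1+λ)I)) ⊕ {A ⊕ A : A ∈ {B}''}. -/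
set_option synthInstance.maxHeartbeats 400000
set_option maxHeartbeats 1000000

noncomputable section

/-- `P` is an orthogonal projection: self-adjoint and idempotent. -/
def IsOrthoProj {H : Type*} [NormedAddCommGroup H] [InnerProductSpace ℂ H] [CompleteSpace H]
    (P : H →L[ℂ] H) : Prop :=
  IsSelfAdjoint P ∧ P * P = P

/-- Strict operator inequality `A < B`: `B − A` is positive and injective. -/
def OpLt {H : Type*} [NormedAddCommGroup H] [InnerProductSpace ℂ H] [CompleteSpace H]
    (A B : H →L[ℂ] H) : Prop :=
  (B - A).IsPositive ∧ Function.Injective (B - A)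

/-- The block operator `[[A, B], [C, D]]` on the Hilbert space direct sum `K ⊕₂ K`. -/
def blk {K : Type*} [NormedAddCommGroup K] [InnerProductSpace ℂ K]
    (A B C D : K →L[ℂ] K) : WithLp 2 (K × K) →L[ℂ] WithLp 2 (K × K) :=
  ((WithLp.prodContinuousLinearEquiv 2 ℂ K K).symm : K × K →L[ℂ] WithLp 2 (K × K)) ∘L
    ((A.coprod B).prod (C.coprod D)) ∘L
    ((WithLp.prodContinuousLinearEquiv 2 ℂ K K) : WithLp 2 (K × K) →L[ℂ] K × K)

/-- Block-diagonal operator `A ⊕ C` on the Hilbert space direct sum `E ⊕₂ F`. -/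
def dsum {E F : Type*} [NormedAddCommGroup E] [InnerProductSpace ℂ E]
    [NormedAddCommGroup F] [InnerProductSpace ℂ F]
    (A : E →L[ℂ] E) (C : F →L[ℂ] F) : WithLp 2 (E × F) →L[ℂ] WithLp 2 (E × F) :=
  ((WithLp.prodContinuousLinearEquiv 2 ℂ E F).symm : E × F →L[ℂ] WithLp 2 (E × F)) ∘L
    (A.prodMap C) ∘L
    ((WithLp.prodContinuousLinearEquiv 2 ℂ E F) : WithLp 2 (E × F) →L[ℂ] E × F)

/-- The set of pairs of projections `(P, Q)` with `T = λP + Q`. -/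
def pencilPairs {H : Type*} [NormedAddCommGroup H] [InnerProductSpace ℂ H] [CompleteSpace H]
    (lam : ℝ) (T : H →L[ℂ] H) : Set ((H →L[ℂ] H) × (H →L[ℂ] H)) :=
  {PQ | IsOrthoProj PQ.1 ∧ IsOrthoProj PQ.2 ∧ T = (lam : ℂ) • PQ.1 + PQ.2}

/-- The generating set of projections `{P : (P,Q) ∈ 𝒯_λ} ∪ {Q : (P,Q) ∈ 𝒯_λ}`. -/
def pencilGens {H : Type*} [NormedAddCommGroup H] [InnerProductSpace ℂ H] [CompleteSpace H]
    (lam : ℝ) (T : H →L[ℂ] H) : Set (H →L[ℂ] H) :=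
  Prod.fst '' pencilPairs lam T ∪ Prod.snd '' pencilPairs lam T

section Blocks

theorem toLp_eq_iff {E F : Type*} {x x' : E} {y y' : F} :
    WithLp.toLp 2 (x, y) = WithLp.toLp 2 (x', y') ↔ x = x' ∧ y = y' := by
  rw [(WithLp.toLp_injective 2).eq_iff, Prod.mk.injEq]

variable {E F K : Type*}
  [NormedAddCommGroup E] [InnerProductSpace ℂ E]
  [NormedAddCommGroup F] [InnerProductSpace ℂ F]
  [NormedAddCommGroup K] [InnerProductSpace ℂ K]

theorem dsum_apply (A : E →L[ℂ] E) (C : F →L[ℂ] F) (x : WithLp 2 (E × F)) :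
    dsum A C x = WithLp.toLp 2 (A x.fst, C x.snd) := rfl

theorem blk_apply (A B C D : K →L[ℂ] K) (x : WithLp 2 (K × K)) :
    blk A B C D x = WithLp.toLp 2 (A x.fst + B x.snd, C x.fst + D x.snd) := rfl

theorem withLp_prod_ext {E F : Type*} {x y : WithLp 2 (E × F)} (h₁ : x.fst = y.fst)
    (h₂ : x.snd = y.snd) : x = y :=
  WithLp.ofLp_injective 2 (Prod.ext h₁ h₂)

theorem dsum_inj {A A' : E →L[ℂ] E} {C C' : F →L[ℂ] F} :
    dsum A C = dsum A' C' ↔ A = A' ∧ C = C' := by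
  refine ⟨fun h => ⟨?_, ?_⟩, fun h => by rw [h.1, h.2]⟩
  · ext x
    have := DFunLike.congr_fun h (WithLp.toLp 2 (x, 0))
    exact (toLp_eq_iff.1 this).1
  · ext x
    have := DFunLike.congr_fun h (WithLp.toLp 2 (0, x))
    exact (toLp_eq_iff.1 this).2

theorem dsum_mul (A A' : E →L[ℂ] E) (C C' : F →L[ℂ] F) :
    dsum A C * dsum A' C' = dsum (A * A') (C * C') := rfl

theorem dsum_add (A A' : E →L[ℂ] E) (C C' : F →L[ℂ] F) :
    dsum A C + dsum A' C' = dsum (A + A') (C + C') := rfl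

theorem dsum_sub (A A' : E →L[ℂ] E) (C C' : F →L[ℂ] F) :
    dsum A C - dsum A' C' = dsum (A - A') (C - C') := rfl

theorem dsum_smul (c : ℂ) (A : E →L[ℂ] E) (C : F →L[ℂ] F) :
    c • dsum A C = dsum (c • A) (c • C) := rfl

theorem dsum_one : dsum (1 : E →L[ℂ] E) (1 : F →L[ℂ] F) = 1 := rfl

theorem dsum_zero : dsum (0 : E →L[ℂ] E) (0 : F →L[ℂ] F) = 0 := rfl

theorem star_dsum [CompleteSpace E] [CompleteSpace F] (A : E →L[ℂ] E) (C : F →L[ℂ] F) :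
    star (dsum A C) = dsum (star A) (star C) := by
  refine ((ContinuousLinearMap.eq_adjoint_iff _ _).2 fun x y => ?_).symm
  simp [dsum_apply, WithLp.prod_inner_apply, ContinuousLinearMap.star_eq_adjoint,
    ContinuousLinearMap.adjoint_inner_left]

theorem blk_inj {A B C D A' B' C' D' : K →L[ℂ] K} :
    blk A B C D = blk A' B' C' D' ↔ A = A' ∧ B = B' ∧ C = C' ∧ D = D' := by
  refine ⟨fun h => ?_, fun h => by rw [h.1, h.2.1, h.2.2.1, h.2.2.2]⟩
  have h₁ (x : K) := toLp_eq_iff.1 (DFunLike.congr_fun h (WithLp.toLp 2 (x, 0)))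
  have h₂ (x : K) := toLp_eq_iff.1 (DFunLike.congr_fun h (WithLp.toLp 2 (0, x)))
  simp at h₁ h₂
  exact ⟨by ext x; exact (h₁ x).1, by ext x; exact (h₂ x).1, by ext x; exact (h₁ x).2,
    by ext x; exact (h₂ x).2⟩

theorem blk_mul (A B C D A' B' C' D' : K →L[ℂ] K) :
    blk A B C D * blk A' B' C' D' =
      blk (A * A' + B * C') (A * B' + B * D') (C * A' + D * C') (C * B' + D * D') := by
  ext x
  simp [blk_apply, add_add_add_comm]

theorem blk_add (A B C D A' B' C' D' : K →L[ℂ] K) :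
    blk A B C D + blk A' B' C' D' = blk (A + A') (B + B') (C + C') (D + D') := by
  ext x
  refine withLp_prod_ext ?_ ?_ <;> simp [blk_apply, add_add_add_comm]

theorem blk_smul (c : ℂ) (A B C D : K →L[ℂ] K) :
    c • blk A B C D = blk (c • A) (c • B) (c • C) (c • D) := by
  ext x
  refine withLp_prod_ext ?_ ?_ <;> simp [blk_apply]

theorem blk_zero : blk (0 : K →L[ℂ] K) 0 0 0 = 0 := by
  ext x
  refine withLp_prod_ext ?_ ?_ <;> simp [blk_apply]

theorem blk_one : blk (1 : K →L[ℂ] K) 0 0 1 = 1 := by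
  ext x
  refine withLp_prod_ext ?_ ?_ <;> simp [blk_apply]

theorem star_blk [CompleteSpace K] (A B C D : K →L[ℂ] K) :
    star (blk A B C D) = blk (star A) (star C) (star B) (star D) := by
  refine ((ContinuousLinearMap.eq_adjoint_iff _ _).2 fun x y => ?_).symm
  simp only [blk_apply, WithLp.prod_inner_apply, ContinuousLinearMap.star_eq_adjoint,
    ContinuousLinearMap.adjoint_inner_left, inner_add_left, inner_add_right]
  ring!

theorem exists_eq_blk (X : WithLp 2 (K × K) →L[ℂ] WithLp 2 (K × K)) :
    ∃ A B C D : K →L[ℂ] K, X = blk A B C D := by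
  let e := WithLp.prodContinuousLinearEquiv 2 ℂ K K
  let Y : K × K →L[ℂ] K × K := (e : _ →L[ℂ] K × K) ∘L X ∘L (e.symm : K × K →L[ℂ] _)
  refine ⟨.fst ℂ K K ∘L Y ∘L .inl ℂ K K, .fst ℂ K K ∘L Y ∘L .inr ℂ K K,
    .snd ℂ K K ∘L Y ∘L .inl ℂ K K, .snd ℂ K K ∘L Y ∘L .inr ℂ K K, ?_⟩
  have key (x : WithLp 2 (K × K)) :
      X x = X (WithLp.toLp 2 (x.fst, 0)) + X (WithLp.toLp 2 (0, x.snd)) := by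
    rw [← map_add]
    congr 1
    exact withLp_prod_ext (by simp) (by simp)
  ext x
  refine withLp_prod_ext ?_ ?_
  · rw [key x]; rfl
  · rw [key x]; rfl

theorem eq_dsum_of_commute {X : WithLp 2 (E × F) →L[ℂ] WithLp 2 (E × F)}
    (h : Commute X (dsum 1 0)) : ∃ A C, X = dsum A C := by
  let e := WithLp.prodContinuousLinearEquiv 2 ℂ E F
  let Y : E × F →L[ℂ] E × F := (e : _ →L[ℂ] E × F) ∘L X ∘L (e.symm : E × F →L[ℂ] _)
  refine ⟨.fst ℂ E F ∘L Y ∘L .inl ℂ E F, .snd ℂ E F ∘L Y ∘L .inr ℂ E F, ?_⟩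
  have h₁ (x : WithLp 2 (E × F)) : X (WithLp.toLp 2 (x.fst, 0)) = WithLp.toLp 2 ((X x).fst, 0) :=
    DFunLike.congr_fun h.eq x
  have h₂ (x : WithLp 2 (E × F)) : X (WithLp.toLp 2 (0, x.snd)) = WithLp.toLp 2 (0, (X x).snd) := by
    have : WithLp.toLp 2 (0, x.snd) = x - WithLp.toLp 2 (x.fst, 0) :=
      withLp_prod_ext (by simp) (by simp)
    rw [this, map_sub, h₁]
    exact withLp_prod_ext (by simp) (by simp)
  ext x
  refine withLp_prod_ext ?_ ?_
  · change _ = (X (WithLp.toLp 2 (x.fst, 0))).fst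
    rw [h₁]; rfl
  · change _ = (X (WithLp.toLp 2 (0, x.snd))).snd
    rw [h₂]; rfl

theorem dsum_injective {A : E →L[ℂ] E} {C : F →L[ℂ] F} (hA : Function.Injective A)
    (hC : Function.Injective C) : Function.Injective (dsum A C) := fun x y h => by
  rw [dsum_apply, dsum_apply, toLp_eq_iff] at h
  exact withLp_prod_ext (hA h.1) (hC h.2)

theorem blk_antidiagonal_injective {w : K →L[ℂ] K} (hw : Function.Injective w) :
    Function.Injective (blk 0 w w 0) := fun x y h => by
  simp only [blk_apply, toLp_eq_iff, zero_apply, zero_add, add_zero] at h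
  exact withLp_prod_ext (hw h.2) (hw h.1)

theorem commute_dsum_iff {A A' : E →L[ℂ] E} {C C' : F →L[ℂ] F} :
    Commute (dsum A C) (dsum A' C') ↔ Commute A A' ∧ Commute C C' := by
  simp only [Commute, SemiconjBy, dsum_mul, dsum_inj]

theorem exists_eq_smul_one_of_commute_all {A : E →L[ℂ] E} (h : ∀ X, Commute A X) :
    ∃ c : ℂ, A = c • 1 := by
  have hA : A ∈ Subalgebra.center ℂ (E →L[ℂ] E) :=
    Subalgebra.mem_center_iff.2 fun X => (h X).symm.eq
  rw [Algebra.IsCentral.center_eq_bot, Algebra.mem_bot] at hA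
  obtain ⟨c, rfl⟩ := hA
  exact ⟨c, Algebra.algebraMap_eq_smul_one c⟩

end Blocks

section CStarAlgebra

variable {A : Type*} [CStarAlgebra A]

theorem smul_eq_smul_compress_of_pencil {P T e : A} {lam t : ℂ} (hP : P * P = P)
    (hQ : (T - lam • P) * (T - lam • P) = T - lam • P) (he : e * e = e)
    (hTe : T * e = t • e) (heT : e * T = t • e) :
    (t ^ 2 - t) • e = (lam * (2 * t - lam - 1)) • (e * P * e) := by
  have h := congr(e * $hQ * e)
  have h₁ : e * (T * T) * e = (t * t) • e := by
    rw [show e * (T * T) * e = (e * T) * (T * e) by noncomm_ring, heT, hTe, smul_mul_smul_comm, he]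
  have h₂ : e * (T * P) * e = t • (e * P * e) := by
    rw [← mul_assoc e T P, heT]; simp only [smul_mul_assoc]
  have h₃ : e * (P * T) * e = t • (e * P * e) := by
    rw [show e * (P * T) * e = e * P * (T * e) by noncomm_ring, hTe, mul_smul_comm]
  have h₄ : e * T * e = t • e := by rw [heT, smul_mul_assoc, he]
  simp only [sub_mul, mul_sub, smul_mul_assoc, mul_smul_comm, hP, h₁, h₂, h₃, h₄] at h
  rw [← sub_eq_zero] at h ⊢
  rw [← h]
  module

theorem mul_eq_smul_of_compress_eq_smul {P e : A} {c : ℝ} (hP : IsSelfAdjoint P) (hPP : P * P = P)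
    (he : IsSelfAdjoint e) (hee : e * e = e) (hc : c * c = c) (h : e * P * e = (c : ℂ) • e) :
    P * e = (c : ℂ) • e := by
  have hc' : (c : ℂ) * c = c := by exact_mod_cast hc
  have hP' : e * P * (P * e) = e * P * e := by
    rw [show e * P * (P * e) = e * (P * P) * e by noncomm_ring, hPP]
  rw [← sub_eq_zero, ← CStarRing.star_mul_self_eq_zero_iff, star_sub, star_mul, star_smul,
    hP.star_eq, he.star_eq, Complex.star_def, Complex.conj_ofReal]
  simp only [sub_mul, mul_sub, smul_mul_assoc, mul_smul_comm, hP', ← mul_assoc e P e, h, hee,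
    smul_smul, hc', sub_self, smul_zero]

theorem commute_of_commute_of_isSelfAdjoint {D X e : A} (hD : IsSelfAdjoint D)
    (he : IsSelfAdjoint e) (hDe : D * e = D) (hinj : ∀ y, e * y = y → D * y = 0 → y = 0)
    (hee : e * e = e) (hX : Commute D X) : Commute e X := by
  have heD : e * D = D := by simpa [hD.star_eq, he.star_eq] using congr(star $hDe)
  have key (Y : A) (hY : Commute D Y) : e * Y * e = e * Y := by
    refine (sub_eq_zero.1 (hinj (e * Y - e * Y * e) ?_ ?_)).symm
    · simp only [mul_sub, ← mul_assoc, hee]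
    · simp only [mul_sub, ← mul_assoc, hDe, hY.eq]
      rw [mul_assoc, hDe, sub_self]
  have h₁ := key X hX
  have h₂ := congr(star $(key (star X) (by simpa [hD.star_eq] using hX.star_star)))
  simp only [star_mul, star_star, he.star_eq, ← mul_assoc] at h₂
  exact h₁.symm.trans h₂

variable [PartialOrder A] [StarOrderedRing A]

theorem commute_sqrt {a y : A} (h : Commute a y) : Commute (CFC.sqrt a) y :=
  h.cfcₙ_nnreal _

theorem commute_of_commute_mul_self {b y : A} (hb : 0 ≤ b) (h : Commute (b * b) y) :
    Commute b y := by
  simpa only [CFC.sqrt_mul_self b hb] using commute_sqrt h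

theorem eq_zero_of_mul_add_mul_eq_zero {b y : A} (hb : 0 ≤ b) (hinj : ∀ z, b * z = 0 → z = 0)
    (h : b * y + y * b = 0) : y = 0 := by
  have h' : b * y = -(y * b) := eq_neg_of_add_eq_zero_left h
  have hc : Commute b y := commute_of_commute_mul_self hb <| by
    change b * b * y = y * (b * b)
    rw [mul_assoc, h', mul_neg, ← mul_assoc, h', neg_mul, neg_neg, mul_assoc]
  rw [← hc.eq, ← two_smul ℂ, smul_eq_zero] at h
  exact hinj y (h.resolve_left two_ne_zero)

theorem commute_of_mul_add_mul_eq {b r f : A} (hb : 0 ≤ b) (hinj : ∀ z, b * z = 0 → z = 0)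
    (hf : Commute b f) (h : b * r + r * b = f) : Commute b r := by
  refine sub_eq_zero.1 (eq_zero_of_mul_add_mul_eq_zero hb hinj ?_)
  have := hf.eq
  rw [← h, ← sub_eq_zero] at this
  rw [← this]
  noncomm_ring

theorem commute_of_commute_unitary {b x y : A} (hb : IsSelfAdjoint b)
    (h : ∀ u : A, u ∈ unitary A → Commute b u → Commute x u) (hy : Commute b y) :
    Commute x y := by
  rcases eq_or_ne y 0 with rfl | hy0
  · exact Commute.zero_right x
  have aux (a : selfAdjoint A) (ha : ‖a‖ ≤ 1) (hba : Commute b (a : A)) :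
      Commute x (selfAdjoint.unitarySelfAddISMul a ha +
        star (selfAdjoint.unitarySelfAddISMul a ha : A)) := by
    have hbu : Commute b (selfAdjoint.unitarySelfAddISMul a ha : A) := by
      rw [selfAdjoint.unitarySelfAddISMul_coe]
      refine hba.add_right (Commute.smul_right (commute_sqrt ?_).symm _)
      exact ((Commute.one_right b).sub_right (hba.pow_right 2)).symm
    have hu := (selfAdjoint.unitarySelfAddISMul a ha).2
    refine (h _ hu hbu).add_right (h _ (Unitary.star_mem hu) ?_)
    simpa [hb.star_eq] using hbu.star_star
  have hy' : Commute b (star y) := by simpa [hb.star_eq] using hy.star_star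
  rw [CStarAlgebra.norm_smul_two_inv_smul_add_four_unitary y hy0]
  refine Commute.smul_right (Commute.smul_right (Commute.add_right (aux _ _ ?_)
    (Commute.smul_right (aux _ _ ?_) _)) _) _
  · rw [realPart_apply_coe]
    refine Commute.smul_right (Commute.add_right (hy.smul_right _) ?_) _
    rw [star_smul]; exact hy'.smul_right _
  · rw [imaginaryPart_apply_coe]
    refine Commute.smul_right (Commute.smul_right (Commute.sub_right (hy.smul_right _) ?_) _) _
    rw [star_smul]; exact hy'.smul_right _

theorem exists_halmos_pair {b : A} {lam m M : ℝ} (hlam : lam ≠ 0) (hm : 0 < m)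
    (hmul : m ^ 2 * M ^ 2 = ((lam ^ 2 - 1) / 4) ^ 2) (hadd : m ^ 2 + M ^ 2 = (lam ^ 2 + 1) / 2)
    (hM : 0 ≤ M) (hmb : (m : ℂ) • (1 : A) ≤ b) (hbM : b ≤ (M : ℂ) • (1 : A))
    (hm_inj : ∀ y, (b - (m : ℂ) • 1) * y = 0 → y = 0)
    (hM_inj : ∀ y, ((M : ℂ) • 1 - b) * y = 0 → y = 0) :
    (∀ y, b * y = 0 → y = 0) ∧
    ∃ r w : A, IsSelfAdjoint r ∧ IsSelfAdjoint w ∧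
      (∀ y, Commute b y → Commute r y ∧ Commute w y) ∧ (∀ y, w * y = 0 → y = 0) ∧
      r * r + w * w = (1 / 4 : ℂ) • 1 ∧
      (2 * lam : ℂ) • (b * r) = b * b + ((lam ^ 2 - 1) / 4 : ℂ) • 1 := by
  have hsmul (x : ℝ) (hx : 0 ≤ x) : 0 ≤ (x : ℂ) • (1 : A) := by
    rw [Complex.coe_smul]; exact smul_nonneg hx zero_le_one
  have hsa (x : ℝ) : IsSelfAdjoint ((x : ℂ) • (1 : A)) := by
    rw [Complex.coe_smul]; exact (IsSelfAdjoint.all x).smul (.one A)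
  have hm1 := hsmul m hm.le
  have hM1 := hsmul M hM
  have hb : 0 ≤ b := hm1.trans hmb
  have hb_sa : IsSelfAdjoint b := .of_nonneg hb
  have hunit (a : A) (ha : (m : ℂ) • (1 : A) ≤ a) : IsUnit a := by
    refine CStarAlgebra.isUnit_of_le _ ha (IsUnit.isStrictlyPositive ?_ hm1)
    rw [← Algebra.algebraMap_eq_smul_one]
    exact (IsUnit.mk0 (m : ℂ) (by exact_mod_cast hm.ne')).map _
  have hunit_inj (a : A) (ha : IsUnit a) (y : A) (hy : a * y = 0) : y = 0 := by
    rwa [ha.mul_right_eq_zero] at hy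
  have hbu := hunit b hmb
  refine ⟨hunit_inj b hbu, ?_⟩
  obtain ⟨u, hu⟩ := hbu
  set c : A := ↑u⁻¹ with hc
  have hbc : b * c = 1 := by rw [← hu, hc]; simp
  have hcb : c * b = 1 := by rw [← hu, hc]; simp
  have hc_comm (y : A) (hy : Commute b y) : Commute c y := by
    rw [← hu] at hy; exact hy.units_inv_left
  have hcs : IsSelfAdjoint c := by
    have h : b * star c = 1 := by simpa [hb_sa.star_eq] using congr(star $hcb)
    calc star c = c * b * star c := by rw [hcb, one_mul]
      _ = c := by rw [mul_assoc, h, mul_one]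
  have hcomm_one (x : ℂ) (y : A) : Commute (x • (1 : A)) y := (Commute.one_left y).smul_left x
  have h₁ (y : A) (hy : Commute b y) : Commute ((M : ℂ) • 1 - b) y := (hcomm_one _ y).sub_left hy
  have h₂ (y : A) (hy : Commute b y) : Commute ((M : ℂ) • 1 + b) y := (hcomm_one _ y).add_left hy
  have h₃ (y : A) (hy : Commute b y) : Commute (b - (m : ℂ) • 1) y := hy.sub_left (hcomm_one _ y)
  have h₄ (y : A) (hy : Commute b y) : Commute (b + (m : ℂ) • 1) y := hy.add_left (hcomm_one _ y)
  have h₁₂ (y : A) (hy : Commute b y) := (h₁ y hy).mul_left (h₂ y hy)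
  have h₃₄ (y : A) (hy : Commute b y) := (h₃ y hy).mul_left (h₄ y hy)
  set n : A := ((M : ℂ) • 1 - b) * ((M : ℂ) • 1 + b) * ((b - (m : ℂ) • 1) * (b + (m : ℂ) • 1))
    with hn
  have hn_comm (y : A) (hy : Commute b y) : Commute n y := (h₁₂ y hy).mul_left (h₃₄ y hy)
  have hn_nonneg : 0 ≤ n := by
    refine Commute.mul_nonneg ?_ ?_ (h₁₂ _ (h₃₄ b rfl).symm)
    · exact Commute.mul_nonneg (sub_nonneg.2 hbM) (add_nonneg hM1 hb) (h₁ _ (h₂ b rfl).symm)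
    · exact Commute.mul_nonneg (sub_nonneg.2 hmb) (add_nonneg hb hm1) (h₃ _ (h₄ b rfl).symm)
  have hn_inj (y : A) (hy : n * y = 0) : y = 0 := by
    simp only [hn, mul_assoc] at hy
    exact hunit_inj _ (hunit _ (le_add_of_nonneg_left hb)) _ <| hm_inj _ <|
      hunit_inj _ (hunit _ (hmb.trans (le_add_of_nonneg_left hM1))) _ <| hM_inj _ hy
  set s := CFC.sqrt n with hs
  have hss : s * s = n := CFC.sqrt_mul_sqrt_self n
  have hs_sa : IsSelfAdjoint s := .of_nonneg (CFC.sqrt_nonneg n)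
  have hs_comm (y : A) (hy : Commute b y) : Commute s y := commute_sqrt (hn_comm y hy)
  have hcs_comm : Commute c s := hc_comm s (hs_comm b rfl).symm
  have hlamC : (lam : ℂ) ≠ 0 := by exact_mod_cast hlam
  have hk_sa (x : ℝ) {a : A} (ha : IsSelfAdjoint a) : IsSelfAdjoint ((x : ℂ) • a) := by
    rw [Complex.coe_smul]; exact (IsSelfAdjoint.all x).smul ha
  have hbc' (y : A) : b * (c * y) = y := by rw [← mul_assoc, hbc, one_mul]
  have hcb' (y : A) : c * (b * y) = y := by rw [← mul_assoc, hcb, one_mul]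
  have hmulC : (m : ℂ) ^ 2 * M ^ 2 = ((lam ^ 2 - 1) / 4) ^ 2 := by exact_mod_cast hmul
  have haddC : (m : ℂ) ^ 2 + M ^ 2 = (lam ^ 2 + 1) / 2 := by exact_mod_cast hadd
  refine ⟨(((2 * lam)⁻¹ : ℝ) : ℂ) • (b + (((lam ^ 2 - 1) / 4 : ℝ) : ℂ) • c),
    (((2 * lam)⁻¹ : ℝ) : ℂ) • (c * s),
    hk_sa _ (hb_sa.add (hk_sa _ hcs)), hk_sa _ ?_, ?_, ?_, ?_, ?_⟩
  · exact (hcs.commute_iff hs_sa).1 hcs_comm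
  · exact fun y hy => ⟨(hy.add_left ((hc_comm y hy).smul_left _)).smul_left _,
      ((hc_comm y hy).mul_left (hs_comm y hy)).smul_left _⟩
  · intro y hy
    rw [smul_mul_assoc, smul_eq_zero, mul_assoc] at hy
    have h := hy.resolve_left (by exact_mod_cast inv_ne_zero (mul_ne_zero two_ne_zero hlam))
    have h' : s * y = 0 := by rw [← hbc' (s * y), h, mul_zero]
    exact hn_inj y (by rw [← hss, mul_assoc, h', mul_zero])
  · have hw : c * s * (c * s) = (M : ℂ) ^ 2 • 1 - b * b - ((m : ℂ) ^ 2 * M ^ 2) • (c * c)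
        + (m : ℂ) ^ 2 • 1 := by
      rw [hcs_comm.symm.mul_mul_mul_comm, hss, hn]
      simp only [mul_add, add_mul, mul_sub, sub_mul, smul_mul_assoc, mul_smul_comm, mul_one,
        one_mul, mul_assoc, hcb, hcb']
      module
    rw [smul_mul_smul_comm, smul_mul_smul_comm, hw, hmulC, eq_sub_of_add_eq haddC]
    simp only [mul_add, add_mul, smul_mul_assoc, mul_smul_comm, hbc, hcb]
    push_cast
    match_scalars <;> field_simp <;> ring
  · simp only [mul_add, mul_smul_comm, hbc]
    push_cast
    match_scalars <;> field_simp

end CStarAlgebra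

theorem mem_centralizer_singleton_iff_commute {R : Type*} [Mul R] {b y : R} :
    y ∈ Set.centralizer {b} ↔ Commute b y := by
  simp [Set.mem_centralizer_iff, Commute, SemiconjBy]

section Pencil

theorem mul_add_mul_eq_of_pencil {R : Type*} [Ring R] [Algebra ℂ R] {S P : R} {lam : ℂ}
    (hlam : lam ≠ 0) (hP : P * P = P)
    (hQ : (S + ((1 + lam) / 2) • 1 - lam • P) * (S + ((1 + lam) / 2) • 1 - lam • P) =
      S + ((1 + lam) / 2) • 1 - lam • P) :
    S * P + P * S = lam⁻¹ • (S * S + ((lam ^ 2 - 1) / 4) • 1) + S := by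
  simp only [mul_add, add_mul, mul_sub, sub_mul, smul_mul_assoc, mul_smul_comm, mul_one, one_mul,
    hP] at hQ
  linear_combination (norm := skip) (-lam⁻¹) • hQ
  match_scalars <;> field_simp <;> ring

variable {K : Type*} [NormedAddCommGroup K] [InnerProductSpace ℂ K]

theorem apply_eq_zero_of_mul_eq_zero {w : K →L[ℂ] K} (hw : ∀ y : K →L[ℂ] K, w * y = 0 → y = 0)
    {x : K} (hx : w x = 0) : x = 0 := by
  have h := hw ((innerSL ℂ x).smulRight x) (by ext v; simp [hx])
  simpa using DFunLike.congr_fun h x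

theorem mul_eq_zero_of_injective {w y : K →L[ℂ] K} (hw : Function.Injective w) (h : w * y = 0) :
    y = 0 := by
  ext v
  exact hw (by simpa using DFunLike.congr_fun h v)

theorem exists_eq_dsum_of_commute {H₀ H₁ H₂ H₃ E : Type*}
    [NormedAddCommGroup H₀] [InnerProductSpace ℂ H₀]
    [NormedAddCommGroup H₁] [InnerProductSpace ℂ H₁]
    [NormedAddCommGroup H₂] [InnerProductSpace ℂ H₂]
    [NormedAddCommGroup H₃] [InnerProductSpace ℂ H₃]
    [NormedAddCommGroup E] [InnerProductSpace ℂ E]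
    {X : WithLp 2 (H₀ × WithLp 2 (H₁ × WithLp 2 (H₂ × WithLp 2 (H₃ × E)))) →L[ℂ]
      WithLp 2 (H₀ × WithLp 2 (H₁ × WithLp 2 (H₂ × WithLp 2 (H₃ × E))))}
    (h₀ : Commute X (dsum 1 0)) (h₁ : Commute X (dsum 0 (dsum 1 0)))
    (h₂ : Commute X (dsum 0 (dsum 0 (dsum 1 0))))
    (h₃ : Commute X (dsum 0 (dsum 0 (dsum 0 (dsum 1 0))))) :
    ∃ A₀ A₁ A₂ A₃ Y, X = dsum A₀ (dsum A₁ (dsum A₂ (dsum A₃ Y))) := by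
  obtain ⟨A₀, X, rfl⟩ := eq_dsum_of_commute h₀
  obtain ⟨A₁, X, rfl⟩ := eq_dsum_of_commute (commute_dsum_iff.1 h₁).2
  simp only [commute_dsum_iff] at h₂ h₃
  obtain ⟨A₂, X, rfl⟩ := eq_dsum_of_commute h₂.2.2
  simp only [commute_dsum_iff] at h₃
  obtain ⟨A₃, X, rfl⟩ := eq_dsum_of_commute h₃.2.2.2
  exact ⟨A₀, A₁, A₂, A₃, X, rfl⟩

variable [CompleteSpace K]

theorem isOrthoProj_dsum {E F : Type*}
    [NormedAddCommGroup E] [InnerProductSpace ℂ E] [CompleteSpace E]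
    [NormedAddCommGroup F] [InnerProductSpace ℂ F] [CompleteSpace F]
    {P : E →L[ℂ] E} {Q : F →L[ℂ] F} (hP : IsOrthoProj P) (hQ : IsOrthoProj Q) :
    IsOrthoProj (dsum P Q) :=
  ⟨by rw [IsSelfAdjoint, star_dsum, hP.1.star_eq, hQ.1.star_eq], by rw [dsum_mul, hP.2, hQ.2]⟩

theorem isOrthoProj_zero : IsOrthoProj (0 : K →L[ℂ] K) :=
  ⟨.zero _, mul_zero 0⟩

theorem isOrthoProj_one : IsOrthoProj (1 : K →L[ℂ] K) :=
  ⟨.one _, mul_one 1⟩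

theorem isOrthoProj_blk {r w u : K →L[ℂ] K} (hr : IsSelfAdjoint r) (hw : IsSelfAdjoint w)
    (hu : u ∈ unitary (K →L[ℂ] K)) (hrw : Commute r w) (hru : Commute r u) (hwu : Commute w u)
    (h : r * r + w * w = (1 / 4 : ℂ) • 1) :
    IsOrthoProj (blk ((1 / 2 : ℂ) • 1 + r) (u * w) (star u * w) ((1 / 2 : ℂ) • 1 - r)) := by
  have hru' : Commute r (star u) := by simpa [hr.star_eq] using hru.star_star
  have hwu' : Commute w (star u) := by simpa [hw.star_eq] using hwu.star_star
  have h₁ : u * w * (star u * w) = w * w := by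
    rw [mul_assoc, ← mul_assoc w, hwu'.eq, mul_assoc, ← mul_assoc,
      (Unitary.mem_iff.1 hu).2, one_mul]
  have h₂ : star u * w * (u * w) = w * w := by
    rw [mul_assoc, ← mul_assoc w, hwu.eq, mul_assoc, ← mul_assoc, (Unitary.mem_iff.1 hu).1, one_mul]
  have h₃ : r * (u * w) = u * w * r := (hru.mul_right hrw).eq
  have h₄ : r * (star u * w) = star u * w * r := (hru'.mul_right hrw).eq
  have hww : w * w = (1 / 4 : ℂ) • 1 - r * r := eq_sub_of_add_eq' h
  refine ⟨?_, ?_⟩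
  · have hhalf : star ((1 / 2 : ℂ) • (1 : K →L[ℂ] K)) = (1 / 2 : ℂ) • 1 := by
      rw [star_smul, star_one]; norm_num
    rw [IsSelfAdjoint, star_blk, star_add, star_sub, hhalf, hr.star_eq, star_mul, star_mul,
      star_star, hw.star_eq, hwu.eq, hwu'.eq]
  · rw [blk_mul, h₁, h₂, hww, blk_inj]
    simp only [add_mul, mul_add, sub_mul, mul_sub, smul_mul_assoc, mul_smul_comm, one_mul, mul_one,
      h₃, h₄]
    refine ⟨?_, ?_, ?_, ?_⟩ <;> module

theorem commute_entries_of_pencil {B a b c d : K →L[ℂ] K} {lam : ℂ} (hlam : lam ≠ 0)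
    (hB : 0 ≤ B) (hinj : ∀ y, B * y = 0 → y = 0) (hP : blk a b c d * blk a b c d = blk a b c d)
    (hQ : (blk B 0 0 (-B) + ((1 + lam) / 2) • 1 - lam • blk a b c d) *
      (blk B 0 0 (-B) + ((1 + lam) / 2) • 1 - lam • blk a b c d) =
        blk B 0 0 (-B) + ((1 + lam) / 2) • 1 - lam • blk a b c d) :
    Commute B a ∧ Commute B b ∧ Commute B c ∧ Commute B d := by
  have key : blk B 0 0 (-B) * blk a b c d + blk a b c d * blk B 0 0 (-B) =
      lam⁻¹ • (blk B 0 0 (-B) * blk B 0 0 (-B) + ((lam ^ 2 - 1) / 4) • 1) + blk B 0 0 (-B) :=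
    mul_add_mul_eq_of_pencil hlam hP hQ
  rw [blk_mul, blk_mul, blk_mul, ← blk_one, blk_add, blk_smul, blk_add, blk_smul, blk_add, blk_inj]
    at key
  simp only [mul_zero, zero_mul, add_zero, zero_add, neg_mul, mul_neg, neg_neg, neg_zero,
    smul_zero] at key
  obtain ⟨h₁, h₂, h₃, h₄⟩ := key
  have hF : Commute B (lam⁻¹ • (B * B + ((lam ^ 2 - 1) / 4) • 1)) :=
    (((Commute.refl B).mul_right rfl).add_right ((Commute.one_right B).smul_right _)).smul_right _
  refine ⟨commute_of_mul_add_mul_eq hB hinj (hF.add_right rfl) h₁, ?_, ?_,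
    commute_of_mul_add_mul_eq hB hinj (f := B - lam⁻¹ • (B * B + ((lam ^ 2 - 1) / 4) • 1))
      ((Commute.refl B).sub_right hF) ?_⟩
  · exact sub_eq_zero.1 (by rw [← h₂]; abel)
  · exact (sub_eq_zero.1 (by rw [← h₃]; abel)).symm
  · rw [← neg_inj, neg_add, h₄]; abel

end Pencil

section Centralizer

variable {H₀ H₁ H₂ H₃ K : Type*}
  [NormedAddCommGroup H₀] [InnerProductSpace ℂ H₀] [CompleteSpace H₀]
  [NormedAddCommGroup H₁] [InnerProductSpace ℂ H₁] [CompleteSpace H₁]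
  [NormedAddCommGroup H₂] [InnerProductSpace ℂ H₂] [CompleteSpace H₂]
  [NormedAddCommGroup H₃] [InnerProductSpace ℂ H₃] [CompleteSpace H₃]
  [NormedAddCommGroup K] [InnerProductSpace ℂ K] [CompleteSpace K]

theorem mem_pencilPairs_of_unitary {lam : ℝ} {B r w u : K →L[ℂ] K}
    (hB : IsSelfAdjoint B) (hr : IsSelfAdjoint r) (hw : IsSelfAdjoint w)
    (hcomm : ∀ y, Commute B y → Commute r y ∧ Commute w y)
    (hrw : r * r + w * w = (1 / 4 : ℂ) • 1)
    (hBr : (2 * lam : ℂ) • (B * r) = B * B + ((lam ^ 2 - 1) / 4 : ℂ) • 1)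
    (hu : u ∈ unitary (K →L[ℂ] K)) (hBu : Commute B u) :
    (dsum (0 : H₀ →L[ℂ] H₀) (dsum (0 : H₁ →L[ℂ] H₁) (dsum (1 : H₂ →L[ℂ] H₂)
        (dsum (1 : H₃ →L[ℂ] H₃)
          (blk ((1 / 2 : ℂ) • 1 + r) (u * w) (star u * w) ((1 / 2 : ℂ) • 1 - r))))),
      dsum (0 : H₀ →L[ℂ] H₀) (dsum (1 : H₁ →L[ℂ] H₁) (dsum (0 : H₂ →L[ℂ] H₂)
        (dsum (1 : H₃ →L[ℂ] H₃)
          (blk ((1 / 2 : ℂ) • 1 + (B - (lam : ℂ) • r)) (u * (-(lam : ℂ) • w))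
            (star u * (-(lam : ℂ) • w)) ((1 / 2 : ℂ) • 1 - (B - (lam : ℂ) • r))))))) ∈
      pencilPairs lam (dsum 0 (dsum 1 (dsum ((lam : ℂ) • 1)
      (dsum (((1 + lam : ℝ) : ℂ) • 1) (blk B 0 0 (-B) + (((1 + lam) / 2 : ℝ) : ℂ) • 1))))) := by
  have hru := (hcomm u hBu).1
  have hwu := (hcomm u hBu).2
  have hBr' : Commute B r := (hcomm B rfl).1.symm
  have hBw : Commute B w := (hcomm B rfl).2.symm
  have hrw' : Commute r w := (hcomm w hBw).1
  have hlam_sa {a : K →L[ℂ] K} (ha : IsSelfAdjoint a) : IsSelfAdjoint ((lam : ℂ) • a) := by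
    rw [Complex.coe_smul]; exact (IsSelfAdjoint.all lam).smul ha
  refine ⟨?_, ?_, ?_⟩
  · exact isOrthoProj_dsum isOrthoProj_zero <| isOrthoProj_dsum isOrthoProj_zero <|
      isOrthoProj_dsum isOrthoProj_one <| isOrthoProj_dsum isOrthoProj_one <|
      isOrthoProj_blk hr hw hu hrw' hru hwu hrw
  · refine isOrthoProj_dsum isOrthoProj_zero <| isOrthoProj_dsum isOrthoProj_one <|
      isOrthoProj_dsum isOrthoProj_zero <| isOrthoProj_dsum isOrthoProj_one <|
      isOrthoProj_blk (hB.sub (hlam_sa hr)) ?_ hu ?_ ?_ (hwu.smul_left _) ?_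
    · rw [neg_smul]; exact (hlam_sa hw).neg
    · exact ((hBw.sub_left (hrw'.smul_left _))).smul_right _
    · exact hBu.sub_left (hru.smul_left _)
    · have hww : w * w = (1 / 4 : ℂ) • 1 - r * r := eq_sub_of_add_eq' hrw
      have hBB : B * B = (2 * lam : ℂ) • (B * r) - ((lam ^ 2 - 1) / 4 : ℂ) • 1 :=
        eq_sub_of_add_eq hBr.symm
      simp only [sub_mul, mul_sub, smul_mul_assoc, mul_smul_comm, ← hBr'.eq, hww, hBB]
      match_scalars <;> ring
  · simp only [dsum_smul, dsum_add, dsum_inj, blk_smul, blk_add, ← blk_one, blk_inj]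
    push_cast
    refine ⟨by simp, by simp, by simp, by module, ?_, ?_, ?_, ?_⟩
    · module
    · simp
    · simp
    · module

theorem eq_blk_of_commute {B r w a b c d : K →L[ℂ] K} {z : ℂ} (hB : 0 ≤ B)
    (hBinj : ∀ y, B * y = 0 → y = 0) (hw : IsSelfAdjoint w) (hwinj : ∀ y, w * y = 0 → y = 0)
    (hcomm : ∀ y, Commute B y → Commute r y ∧ Commute w y)
    (hS : Commute (blk a b c d) (blk B 0 0 (-B) + z • 1))
    (hP : ∀ u ∈ unitary (K →L[ℂ] K), Commute B u → Commute (blk a b c d)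
      (blk ((1 / 2 : ℂ) • 1 + r) (u * w) (star u * w) ((1 / 2 : ℂ) • 1 - r))) :
    a ∈ Set.centralizer (Set.centralizer {B}) ∧ b = 0 ∧ c = 0 ∧ d = a := by
  have hS' : Commute (blk a b c d) (blk B 0 0 (-B)) := by
    simpa using hS.sub_right ((Commute.one_right (blk a b c d)).smul_right z)
  have hS'' := hS'.eq
  simp only [blk_mul, blk_inj, mul_zero, zero_mul, add_zero, zero_add, mul_neg, neg_mul] at hS''
  obtain ⟨ha, hb, hc, -⟩ := hS''
  have hb0 : b = 0 := eq_zero_of_mul_add_mul_eq_zero hB hBinj (by rw [← hb]; abel)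
  have hc0 : c = 0 := eq_zero_of_mul_add_mul_eq_zero hB hBinj (by rw [hc]; abel)
  subst hb0 hc0
  have hwa : Commute w a := (hcomm a ha.symm).2
  have key (u : K →L[ℂ] K) (hu : u ∈ unitary (K →L[ℂ] K)) (hBu : Commute B u) :
      a * (u * w) = u * w * d := by
    have := (hP u hu hBu).eq
    simp only [blk_mul, blk_inj, mul_zero, zero_mul, add_zero, zero_add] at this
    exact this.2.1
  have hd : d = a := by
    have h := key 1 (one_mem _) (Commute.one_right B)
    rw [one_mul, ← hwa.eq] at h
    exact (sub_eq_zero.1 (hwinj _ (by rw [mul_sub, h, sub_self]))).symm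
  subst hd
  refine ⟨?_, rfl, rfl, rfl⟩
  rw [Set.mem_centralizer_iff]
  intro y hy
  rw [mem_centralizer_singleton_iff_commute] at hy
  refine (commute_of_commute_unitary (.of_nonneg hB) (fun u hu hBu => ?_) hy).eq.symm
  have h := key u hu hBu
  rw [mul_assoc u, hwa.eq, ← mul_assoc, ← mul_assoc, ← sub_eq_zero, ← sub_mul] at h
  have h' := congr(star $h)
  rw [star_mul, hw.star_eq, star_zero] at h'
  exact sub_eq_zero.1 (star_eq_zero.1 (hwinj _ h'))

theorem commute_of_commute_of_injective {V : Type*} [NormedAddCommGroup V] [InnerProductSpace ℂ V]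
    [CompleteSpace V] {D e X : V →L[ℂ] V} (hD : IsSelfAdjoint D) (he : IsSelfAdjoint e)
    (hDe : D * e = D) (hee : e * e = e) (hinj : Function.Injective ⇑(D + (1 - e)))
    (h : Commute X D) : Commute X e := by
  refine (commute_of_commute_of_isSelfAdjoint hD he hDe (fun y hy hDy => ?_) hee h.symm).symm
  refine mul_eq_zero_of_injective hinj ?_
  rw [add_mul, sub_mul, one_mul, hy, sub_self, add_zero, hDy]

theorem commute_dsum_one_of_commute_dsum {E : Type*} [NormedAddCommGroup E]
    [InnerProductSpace ℂ E] [CompleteSpace E] {G : E →L[ℂ] E} (hG : IsSelfAdjoint G)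
    (hinj : Function.Injective G)
    {X : WithLp 2 (H₀ × WithLp 2 (H₁ × WithLp 2 (H₂ × WithLp 2 (H₃ × E)))) →L[ℂ]
      WithLp 2 (H₀ × WithLp 2 (H₁ × WithLp 2 (H₂ × WithLp 2 (H₃ × E))))}
    (h : Commute X (dsum 0 (dsum 0 (dsum 0 (dsum 0 G))))) :
    Commute X (dsum 0 (dsum 0 (dsum 0 (dsum 0 1)))) := by
  refine commute_of_commute_of_injective ?_ ?_ ?_ ?_ ?_ h
  · simp only [IsSelfAdjoint, star_dsum, star_zero, hG.star_eq]
  · simp only [IsSelfAdjoint, star_dsum, star_zero, star_one]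
  · simp only [dsum_mul, mul_zero, mul_one]
  · simp only [dsum_mul, mul_zero, mul_one]
  · simp only [← dsum_one, dsum_sub, dsum_add, sub_zero, zero_add, sub_self, add_zero]
    exact dsum_injective Function.injective_id <| dsum_injective Function.injective_id <|
      dsum_injective Function.injective_id <| dsum_injective Function.injective_id hinj

theorem exists_eq_dsum_of_mem_centralizer {lam : ℝ} {B r w : K →L[ℂ] K} (hB : 0 ≤ B)
    (hBinj : ∀ y, B * y = 0 → y = 0) (hr : IsSelfAdjoint r) (hw : IsSelfAdjoint w)
    (hcomm : ∀ y, Commute B y → Commute r y ∧ Commute w y)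
    (hwinj : ∀ y, w * y = 0 → y = 0)
    (hrw : r * r + w * w = (1 / 4 : ℂ) • 1)
    (hBr : (2 * lam : ℂ) • (B * r) = B * B + ((lam ^ 2 - 1) / 4 : ℂ) • 1)
    {X : WithLp 2 (H₀ × WithLp 2 (H₁ × WithLp 2 (H₂ × WithLp 2 (H₃ × WithLp 2 (K × K))))) →L[ℂ]
         WithLp 2 (H₀ × WithLp 2 (H₁ × WithLp 2 (H₂ × WithLp 2 (H₃ × WithLp 2 (K × K)))))}
    (hX : X ∈ (pencilGens lam (dsum 0 (dsum 1 (dsum ((lam : ℂ) • 1)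
      (dsum (((1 + lam : ℝ) : ℂ) • 1)
        (blk B 0 0 (-B) + (((1 + lam) / 2 : ℝ) : ℂ) • 1)))))).centralizer) :
    ∃ (A₀ : H₀ →L[ℂ] H₀) (A₁ : H₁ →L[ℂ] H₁) (A₂ : H₂ →L[ℂ] H₂) (A₃ : H₃ →L[ℂ] H₃),
        ∃ A ∈ Set.centralizer (Set.centralizer {B}),
          X = dsum A₀ (dsum A₁ (dsum A₂ (dsum A₃ (blk A 0 0 A)))) := by
  have hmem {u : K →L[ℂ] K} (hu : u ∈ unitary (K →L[ℂ] K)) (hBu : Commute B u) :=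
    mem_pencilPairs_of_unitary (H₀ := H₀) (H₁ := H₁) (H₂ := H₂) (H₃ := H₃)
      (IsSelfAdjoint.of_nonneg hB) hr hw hcomm hrw hBr hu hBu
  have hXP {u : K →L[ℂ] K} (hu : u ∈ unitary (K →L[ℂ] K)) (hBu : Commute B u) :=
    (Commute.symm (hX _ (Or.inl ⟨_, hmem hu hBu, rfl⟩)) : Commute X _)
  have hXQ {u : K →L[ℂ] K} (hu : u ∈ unitary (K →L[ℂ] K)) (hBu : Commute B u) :=
    (Commute.symm (hX _ (Or.inr ⟨_, hmem hu hBu, rfl⟩)) : Commute X _)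
  have hone := one_mem (unitary (K →L[ℂ] K))
  have hP := hXP hone (.one_right B)
  have hQ := hXQ hone (.one_right B)
  have hT := (hP.smul_right (lam : ℂ)).add_right hQ
  rw [← (hmem hone (.one_right B)).2.2] at hT
  have he : Commute X (dsum 0 (dsum 0 (dsum 0 (dsum 0 1)))) := by
    have hD := hP.sub_right (hXP (u := -1) (by simp [Unitary.mem_iff])
      (.neg_right (.one_right B)))
    have hG : blk ((1 / 2 : ℂ) • 1 + r) (1 * w) (star 1 * w) ((1 / 2 : ℂ) • 1 - r) -
        blk ((1 / 2 : ℂ) • 1 + r) (-1 * w) (star (-1) * w) ((1 / 2 : ℂ) • 1 - r) =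
          blk 0 ((2 : ℂ) • w) ((2 : ℂ) • w) 0 := by
      rw [sub_eq_iff_eq_add, blk_add, blk_inj]
      simp only [star_neg, star_one, one_mul, neg_mul, zero_add, true_and, and_true]
      constructor <;> module
    simp only [dsum_sub, sub_self, hG] at hD
    refine commute_dsum_one_of_commute_dsum ?_ (blk_antidiagonal_injective ?_) hD
    · rw [IsSelfAdjoint, star_blk, star_smul, hw.star_eq, star_zero, star_ofNat]
    · refine (injective_iff_map_eq_zero _).2 fun x hx => apply_eq_zero_of_mul_eq_zero hwinj ?_
      simpa using hx
  have h₃ : Commute X (dsum 0 (dsum 0 (dsum 0 (dsum 1 0)))) := by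
    simpa [dsum_mul, dsum_sub, dsum_zero, ← dsum_one] using
      (hP.mul_right hQ).mul_right ((Commute.one_right X).sub_right he)
  have h₂ : Commute X (dsum 0 (dsum 0 (dsum 1 0))) := by
    simpa [dsum_mul, dsum_sub, dsum_zero, ← dsum_one] using
      (hP.mul_right ((Commute.one_right X).sub_right he)).sub_right h₃
  have h₁ : Commute X (dsum 0 (dsum 1 0)) := by
    simpa [dsum_mul, dsum_sub, dsum_zero, ← dsum_one] using
      (hQ.mul_right ((Commute.one_right X).sub_right he)).sub_right h₃
  have h₀ : Commute X (dsum 1 0) := by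
    simpa [dsum_mul, dsum_sub, dsum_zero, ← dsum_one] using
      ((((Commute.one_right X).sub_right he).sub_right h₁).sub_right h₂).sub_right h₃
  obtain ⟨A₀, A₁, A₂, A₃, Y, rfl⟩ := exists_eq_dsum_of_commute h₀ h₁ h₂ h₃
  obtain ⟨a, b, c, d, rfl⟩ := exists_eq_blk Y
  simp only [commute_dsum_iff] at hT
  obtain ⟨ha, rfl, rfl, rfl⟩ := eq_blk_of_commute hB hBinj hw hwinj hcomm hT.2.2.2.2
    fun u hu hBu => (by
      have := hXP hu hBu
      simp only [commute_dsum_iff] at this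
      exact this.2.2.2.2)
  exact ⟨A₀, A₁, A₂, A₃, d, ha, rfl⟩

end Centralizer

section DoubleCentralizer

variable {H₀ H₁ H₂ H₃ K : Type*}
  [NormedAddCommGroup H₀] [InnerProductSpace ℂ H₀] [CompleteSpace H₀]
  [NormedAddCommGroup H₁] [InnerProductSpace ℂ H₁] [CompleteSpace H₁]
  [NormedAddCommGroup H₂] [InnerProductSpace ℂ H₂] [CompleteSpace H₂]
  [NormedAddCommGroup H₃] [InnerProductSpace ℂ H₃] [CompleteSpace H₃]
  [NormedAddCommGroup K] [InnerProductSpace ℂ K] [CompleteSpace K]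

theorem exists_eq_dsum_of_mem_pencilPairs_dsum {E F : Type*}
    [NormedAddCommGroup E] [InnerProductSpace ℂ E] [CompleteSpace E]
    [NormedAddCommGroup F] [InnerProductSpace ℂ F] [CompleteSpace F]
    {lam t c : ℝ} {a : E →L[ℂ] E} {S : F →L[ℂ] F} (ha : a = (t : ℂ) • 1)
    (ht : lam * (2 * t - lam - 1) ≠ 0) (htc : t ^ 2 - t = lam * (2 * t - lam - 1) * c)
    (hc : c * c = c) {P Q : WithLp 2 (E × F) →L[ℂ] WithLp 2 (E × F)}
    (h : (P, Q) ∈ pencilPairs lam (dsum a S)) :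
    ∃ p q, P = dsum ((c : ℂ) • 1) p ∧ (p, q) ∈ pencilPairs lam S := by
  obtain ⟨⟨hP, hPP⟩, ⟨hQ, hQQ⟩, hT⟩ := h
  simp only at hP hPP hQ hQQ hT
  subst ha
  rw [← sub_eq_iff_eq_add'] at hT
  subst hT
  have he : IsSelfAdjoint (dsum (1 : E →L[ℂ] E) (0 : F →L[ℂ] F)) := by
    rw [IsSelfAdjoint, star_dsum, star_one, star_zero]
  have hee : dsum (1 : E →L[ℂ] E) (0 : F →L[ℂ] F) * dsum 1 0 = dsum 1 0 := by
    rw [dsum_mul, one_mul, zero_mul]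
  have hcomp := smul_eq_smul_compress_of_pencil (t := (t : ℂ)) hPP hQQ hee
    (by rw [dsum_mul, dsum_smul, mul_one, mul_zero, smul_zero])
    (by rw [dsum_mul, dsum_smul, one_mul, zero_mul, smul_zero])
  have ht' : (lam * (2 * t - lam - 1) : ℂ) ≠ 0 := by exact_mod_cast ht
  have htc' : (t ^ 2 - t : ℂ) = lam * (2 * t - lam - 1) * c := by exact_mod_cast htc
  rw [htc', mul_smul] at hcomp
  have hPe := mul_eq_smul_of_compress_eq_smul hP hPP he hee hc
    (smul_right_injective _ ht' hcomp).symm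
  have hcomm : Commute P (dsum 1 0) := by
    have := congr(star $hPe)
    rw [star_mul, star_smul, hP.star_eq, he.star_eq, Complex.star_def, Complex.conj_ofReal] at this
    exact hPe.trans this.symm
  obtain ⟨p₀, p, rfl⟩ := eq_dsum_of_commute hcomm
  rw [dsum_mul, dsum_smul, dsum_inj, mul_one] at hPe
  obtain ⟨rfl, -⟩ := hPe
  rw [IsSelfAdjoint, star_dsum, dsum_inj] at hP
  rw [dsum_mul, dsum_inj] at hPP
  rw [dsum_smul, dsum_sub] at hQ hQQ
  rw [IsSelfAdjoint, star_dsum, dsum_inj] at hQ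
  rw [dsum_mul, dsum_inj] at hQQ
  exact ⟨p, _, rfl, ⟨hP.2, hPP.2⟩, ⟨hQ.2, hQQ.2⟩, (add_sub_cancel _ _).symm⟩

theorem exists_eq_dsum_of_mem_pencilPairs {E : Type*} [NormedAddCommGroup E]
    [InnerProductSpace ℂ E] [CompleteSpace E] {lam : ℝ} (hlam : lam ≠ -1 ∧ lam ≠ 0 ∧ lam ≠ 1)
    {S : E →L[ℂ] E}
    {P Q : WithLp 2 (H₀ × WithLp 2 (H₁ × WithLp 2 (H₂ × WithLp 2 (H₃ × E)))) →L[ℂ]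
      WithLp 2 (H₀ × WithLp 2 (H₁ × WithLp 2 (H₂ × WithLp 2 (H₃ × E))))}
    (h : (P, Q) ∈ pencilPairs lam (dsum 0 (dsum 1 (dsum ((lam : ℂ) • 1)
      (dsum (((1 + lam : ℝ) : ℂ) • 1) S))))) :
    ∃ p : E →L[ℂ] E, P = dsum 0 (dsum 0 (dsum 1 (dsum 1 p))) := by
  have h₁ : lam + 1 ≠ 0 := fun h => hlam.1 (eq_neg_of_add_eq_zero_left h)
  have h₂ : lam - 1 ≠ 0 := sub_ne_zero.2 hlam.2.2
  have h₃ : lam * (lam + 1) ≠ 0 := mul_ne_zero hlam.2.1 h₁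
  have h₄ : lam * (lam - 1) ≠ 0 := mul_ne_zero hlam.2.1 h₂
  obtain ⟨P₀, Q₀, rfl, k₀⟩ := exists_eq_dsum_of_mem_pencilPairs_dsum (t := 0) (c := 0) (by simp)
    (by convert neg_ne_zero.2 h₃ using 1; ring) (by ring) (by ring) h
  obtain ⟨P₁, Q₁, rfl, k₁⟩ := exists_eq_dsum_of_mem_pencilPairs_dsum (t := 1) (c := 0) (by simp)
    (by convert neg_ne_zero.2 h₄ using 1; ring) (by ring) (by ring) k₀
  obtain ⟨P₂, Q₂, rfl, k₂⟩ := exists_eq_dsum_of_mem_pencilPairs_dsum (t := lam) (c := 1) rfl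
    (by convert h₄ using 1; ring) (by ring) (by ring) k₁
  obtain ⟨P₃, Q₃, rfl, -⟩ := exists_eq_dsum_of_mem_pencilPairs_dsum (t := 1 + lam) (c := 1) rfl
    (by convert h₃ using 1; ring) (by ring) (by ring) k₂
  exact ⟨P₃, by simp only [Complex.ofReal_zero, Complex.ofReal_one, zero_smul, one_smul]⟩

theorem dsum_mem_centralizer_pencilGens {lam : ℝ} (hlam : lam ≠ -1 ∧ lam ≠ 0 ∧ lam ≠ 1)
    {B : K →L[ℂ] K} (hB : 0 ≤ B) (hBinj : ∀ y, B * y = 0 → y = 0)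
    (A₀ : H₀ →L[ℂ] H₀) (A₁ : H₁ →L[ℂ] H₁) (A₂ : H₂ →L[ℂ] H₂) (A₃ : H₃ →L[ℂ] H₃)
    {A : K →L[ℂ] K} (hA : A ∈ Set.centralizer (Set.centralizer {B})) :
    dsum A₀ (dsum A₁ (dsum A₂ (dsum A₃ (blk A 0 0 A)))) ∈
      (pencilGens lam (dsum 0 (dsum 1 (dsum ((lam : ℂ) • 1)
        (dsum (((1 + lam : ℝ) : ℂ) • 1)
          (blk B 0 0 (-B) + (((1 + lam) / 2 : ℝ) : ℂ) • 1)))))).centralizer := by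
  have hA' (y : K →L[ℂ] K) (hy : Commute B y) : y * A = A * y :=
    hA y (mem_centralizer_singleton_iff_commute.2 hy)
  have hBA := hA' B rfl
  have key : ∀ P Q, (P, Q) ∈ pencilPairs lam (dsum (0 : H₀ →L[ℂ] H₀) (dsum (1 : H₁ →L[ℂ] H₁)
      (dsum ((lam : ℂ) • (1 : H₂ →L[ℂ] H₂)) (dsum (((1 + lam : ℝ) : ℂ) • (1 : H₃ →L[ℂ] H₃))
          (blk B 0 0 (-B) + (((1 + lam) / 2 : ℝ) : ℂ) • 1))))) →
      Commute P (dsum A₀ (dsum A₁ (dsum A₂ (dsum A₃ (blk A 0 0 A))))) ∧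
      Commute Q (dsum A₀ (dsum A₁ (dsum A₂ (dsum A₃ (blk A 0 0 A))))) := by
    intro P Q hPQ
    obtain ⟨p, rfl⟩ := exists_eq_dsum_of_mem_pencilPairs hlam hPQ
    obtain ⟨a, b, c, d, rfl⟩ := exists_eq_blk p
    obtain ⟨⟨-, hPP⟩, ⟨-, hQQ⟩, hT⟩ := hPQ
    simp only at hPP hQQ hT
    rw [← sub_eq_iff_eq_add'] at hT
    subst hT
    simp only [dsum_smul, dsum_sub, dsum_mul, dsum_inj] at hPP hQQ
    have hcast : (((1 + lam) / 2 : ℝ) : ℂ) = (1 + lam) / 2 := by push_cast; rfl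
    have hQ₄ := hQQ.2.2.2.2
    rw [hcast] at hQ₄
    obtain ⟨ha, hb, hc, hd⟩ := commute_entries_of_pencil
      (by exact_mod_cast hlam.2.1) hB hBinj hPP.2.2.2.2 hQ₄
    have hp : Commute (blk a b c d) (blk A 0 0 A) := by
      simp [Commute, SemiconjBy, blk_mul, hA' a ha, hA' b hb, hA' c hc, hA' d hd]
    have hS : Commute (blk B 0 0 (-B)) (blk A 0 0 A) := by
      simp [Commute, SemiconjBy, blk_mul, hBA]
    have hP : Commute (dsum 0 (dsum 0 (dsum 1 (dsum 1 (blk a b c d)))))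
        (dsum A₀ (dsum A₁ (dsum A₂ (dsum A₃ (blk A 0 0 A))))) := by
      simpa [commute_dsum_iff] using hp
    refine ⟨hP, Commute.sub_left ?_ (hP.smul_left _)⟩
    simp only [commute_dsum_iff]
    exact ⟨.zero_left _, .one_left _, (Commute.one_left _).smul_left _,
      (Commute.one_left _).smul_left _, hS.add_left ((Commute.one_left _).smul_left _)⟩
  rintro _ (⟨⟨P, Q⟩, h, rfl⟩ | ⟨⟨P, Q⟩, h, rfl⟩)
  · exact (key P Q h).1.eq
  · exact (key P Q h).2.eq

end DoubleCentralizer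

theorem centralizer_dsum_eq {H₀ H₁ H₂ H₃ K : Type*}
    [NormedAddCommGroup H₀] [InnerProductSpace ℂ H₀]
    [NormedAddCommGroup H₁] [InnerProductSpace ℂ H₁]
    [NormedAddCommGroup H₂] [InnerProductSpace ℂ H₂]
    [NormedAddCommGroup H₃] [InnerProductSpace ℂ H₃]
    [NormedAddCommGroup K] [InnerProductSpace ℂ K] (B : K →L[ℂ] K) :
    Set.centralizer {M | ∃ (A₀ : H₀ →L[ℂ] H₀) (A₁ : H₁ →L[ℂ] H₁) (A₂ : H₂ →L[ℂ] H₂)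
        (A₃ : H₃ →L[ℂ] H₃), ∃ A ∈ Set.centralizer (Set.centralizer {B}),
          M = dsum A₀ (dsum A₁ (dsum A₂ (dsum A₃ (blk A 0 0 A))))} =
      {M | ∃ a b c d : ℂ, ∃ A₁₁ ∈ Set.centralizer {B}, ∃ A₁₂ ∈ Set.centralizer {B},
        ∃ A₂₁ ∈ Set.centralizer {B}, ∃ A₂₂ ∈ Set.centralizer {B},
          M = dsum (a • 1) (dsum (b • 1) (dsum (c • 1)
            (dsum (d • 1) (blk A₁₁ A₁₂ A₂₁ A₂₂))))} := by
  have hzero : (0 : K →L[ℂ] K) ∈ Set.centralizer (Set.centralizer {B}) := Set.zero_mem_centralizer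
  have hBB : B ∈ Set.centralizer (Set.centralizer {B}) :=
    Set.subset_centralizer_centralizer rfl
  ext M
  constructor
  · intro hM
    have h (A₀ : H₀ →L[ℂ] H₀) (A₁ : H₁ →L[ℂ] H₁) (A₂ : H₂ →L[ℂ] H₂) (A₃ : H₃ →L[ℂ] H₃)
        {A : K →L[ℂ] K} (hA : A ∈ Set.centralizer (Set.centralizer {B})) :
        Commute M (dsum A₀ (dsum A₁ (dsum A₂ (dsum A₃ (blk A 0 0 A))))) :=
      (hM _ ⟨A₀, A₁, A₂, A₃, A, hA, rfl⟩).symm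
    obtain ⟨A₀, A₁, A₂, A₃, Y, rfl⟩ := exists_eq_dsum_of_commute
      (by simpa only [blk_zero, dsum_zero] using h 1 0 0 0 hzero)
      (by simpa only [blk_zero, dsum_zero] using h 0 1 0 0 hzero)
      (by simpa only [blk_zero, dsum_zero] using h 0 0 1 0 hzero)
      (by simpa only [blk_zero, dsum_zero] using h 0 0 0 1 hzero)
    obtain ⟨a₁₁, a₁₂, a₂₁, a₂₂, rfl⟩ := exists_eq_blk Y
    simp only [commute_dsum_iff] at h
    obtain ⟨a, rfl⟩ := exists_eq_smul_one_of_commute_all fun X => (h X 0 0 0 hzero).1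
    obtain ⟨b, rfl⟩ := exists_eq_smul_one_of_commute_all fun X => (h 0 X 0 0 hzero).2.1
    obtain ⟨c, rfl⟩ := exists_eq_smul_one_of_commute_all fun X => (h 0 0 X 0 hzero).2.2.1
    obtain ⟨d, rfl⟩ := exists_eq_smul_one_of_commute_all fun X => (h 0 0 0 X hzero).2.2.2.1
    have hY := (h 0 0 0 0 hBB).2.2.2.2.eq
    simp only [blk_mul, blk_inj, mul_zero, zero_mul, add_zero, zero_add] at hY
    obtain ⟨h₁, h₂, h₃, h₄⟩ := hY
    simp only [Set.mem_ofPred_eq, mem_centralizer_singleton_iff_commute]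
    exact ⟨a, b, c, d, a₁₁, h₁.symm, a₁₂, h₂.symm, a₂₁, h₃.symm, a₂₂, h₄.symm, rfl⟩
  · rintro ⟨a, b, c, d, a₁₁, h₁, a₁₂, h₂, a₂₁, h₃, a₂₂, h₄, rfl⟩ _ ⟨A₀, A₁, A₂, A₃, A, hA, rfl⟩
    have hblk : blk A 0 0 A * blk a₁₁ a₁₂ a₂₁ a₂₂ = blk a₁₁ a₁₂ a₂₁ a₂₂ * blk A 0 0 A := by
      simp [blk_mul, hA _ h₁, hA _ h₂, hA _ h₃, hA _ h₄]
    simp [dsum_mul, hblk]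

theorem centralizer_pencilGens_eq {H₀ H₁ H₂ H₃ K : Type*}
    [NormedAddCommGroup H₀] [InnerProductSpace ℂ H₀] [CompleteSpace H₀]
    [NormedAddCommGroup H₁] [InnerProductSpace ℂ H₁] [CompleteSpace H₁]
    [NormedAddCommGroup H₂] [InnerProductSpace ℂ H₂] [CompleteSpace H₂]
    [NormedAddCommGroup H₃] [InnerProductSpace ℂ H₃] [CompleteSpace H₃]
    [NormedAddCommGroup K] [InnerProductSpace ℂ K] [CompleteSpace K]
    {lam : ℝ} (hlam : lam ≠ -1 ∧ lam ≠ 0 ∧ lam ≠ 1) {B : K →L[ℂ] K}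
    (hB₁ : OpLt (((abs (1 - |lam|) / 2 : ℝ) : ℂ) • (1 : K →L[ℂ] K)) B)
    (hB₂ : OpLt B ((((1 + |lam|) / 2 : ℝ) : ℂ) • (1 : K →L[ℂ] K))) :
    (pencilGens lam (dsum (0 : H₀ →L[ℂ] H₀) (dsum (1 : H₁ →L[ℂ] H₁)
      (dsum ((lam : ℂ) • (1 : H₂ →L[ℂ] H₂)) (dsum (((1 + lam : ℝ) : ℂ) • (1 : H₃ →L[ℂ] H₃))
          (blk B 0 0 (-B) + (((1 + lam) / 2 : ℝ) : ℂ) • 1)))))).centralizer =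
      {M | ∃ (A₀ : H₀ →L[ℂ] H₀) (A₁ : H₁ →L[ℂ] H₁) (A₂ : H₂ →L[ℂ] H₂) (A₃ : H₃ →L[ℂ] H₃),
        ∃ A ∈ Set.centralizer (Set.centralizer {B}),
          M = dsum A₀ (dsum A₁ (dsum A₂ (dsum A₃ (blk A 0 0 A))))} := by
  have hm : 0 < abs (1 - |lam|) / 2 := by
    refine half_pos (abs_pos.2 fun h => ?_)
    rcases eq_or_eq_neg_of_abs_eq (sub_eq_zero.1 h).symm with h | h
    · exact hlam.2.2 h
    · exact hlam.1 h
  have hsq : |lam| ^ 2 = lam ^ 2 := sq_abs lam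
  have hm2 : (abs (1 - |lam|) / 2) ^ 2 = (1 - |lam|) ^ 2 / 4 := by rw [div_pow, sq_abs]; norm_num
  have hle₁ := (ContinuousLinearMap.le_def _ _).2 hB₁.1
  have hle₂ := (ContinuousLinearMap.le_def _ _).2 hB₂.1
  obtain ⟨hBinj, r, w, hr, hw, hcomm, hwinj, hrw, hBr⟩ :=
    exists_halmos_pair (lam := lam) (M := (1 + |lam|) / 2) hlam.2.1 hm
      (by rw [hm2, ← hsq]; ring) (by rw [hm2, ← hsq]; ring) (by positivity) hle₁ hle₂
      (fun _ => mul_eq_zero_of_injective hB₁.2) (fun _ => mul_eq_zero_of_injective hB₂.2)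
  have hB : 0 ≤ B := by
    refine le_trans ?_ hle₁
    rw [Complex.coe_smul]
    exact smul_nonneg hm.le zero_le_one
  refine Set.Subset.antisymm (fun X hX => ?_) ?_
  · exact exists_eq_dsum_of_mem_centralizer hB hBinj hr hw hcomm hwinj hrw hBr hX
  · rintro _ ⟨A₀, A₁, A₂, A₃, A, hA, rfl⟩
    exact dsum_mem_centralizer_pencilGens hlam hB hBinj A₀ A₁ A₂ A₃ hA

/-- For `λ ∈ ℝ \ {−1, 0, 1}` and `T = 0 ⊕ I ⊕ λI ⊕ (1+λ)I ⊕ ((B ⊕ (−B)) + ((1+λ)/2)I)`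
relative to `H = ker T ⊕ ker(T−I) ⊕ ker(T−λI) ⊕ ker(T−(1+λ)I) ⊕ (K ⊕ K)`, with
`(|1−|λ||/2)I < B < ((1+|λ|)/2)I`, the von Neumann algebra generated by the projections in
`𝒯_λ` is `ℂI ⊕ ℂI ⊕ ℂI ⊕ ℂI ⊕ M₂({B}')` and its commutant is
`B(ker T) ⊕ B(ker(T−I)) ⊕ B(ker(T−λI)) ⊕ B(ker(T−(1+λ)I)) ⊕ {A ⊕ A : A ∈ {B}''}`. -/
theorem pencil_vonNeumann_algebra_full
    {H₀ H₁ H₂ H₃ K : Type*}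
    [NormedAddCommGroup H₀] [InnerProductSpace ℂ H₀] [CompleteSpace H₀]
    [NormedAddCommGroup H₁] [InnerProductSpace ℂ H₁] [CompleteSpace H₁]
    [NormedAddCommGroup H₂] [InnerProductSpace ℂ H₂] [CompleteSpace H₂]
    [NormedAddCommGroup H₃] [InnerProductSpace ℂ H₃] [CompleteSpace H₃]
    [NormedAddCommGroup K] [InnerProductSpace ℂ K] [CompleteSpace K]
    (lam : ℝ) (hlam : lam ≠ -1 ∧ lam ≠ 0 ∧ lam ≠ 1)
    (B : K →L[ℂ] K) (hBpos : B.IsPositive)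
    (hB₁ : OpLt (((abs (1 - |lam|) / 2 : ℝ) : ℂ) • (1 : K →L[ℂ] K)) B)
    (hB₂ : OpLt B ((((1 + |lam|) / 2 : ℝ) : ℂ) • (1 : K →L[ℂ] K)))
    (T : WithLp 2 (H₀ × WithLp 2 (H₁ × WithLp 2 (H₂ × WithLp 2 (H₃ × WithLp 2 (K × K))))) →L[ℂ]
         WithLp 2 (H₀ × WithLp 2 (H₁ × WithLp 2 (H₂ × WithLp 2 (H₃ × WithLp 2 (K × K))))))
    (hT : T = dsum 0 (dsum 1 (dsum ((lam : ℂ) • 1)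
      (dsum (((1 + lam : ℝ) : ℂ) • 1) (blk B 0 0 (-B) + (((1 + lam) / 2 : ℝ) : ℂ) • 1))))) :
    (pencilGens lam T).centralizer.centralizer =
      {M | ∃ a b c d : ℂ, ∃ A₁₁ ∈ Set.centralizer {B}, ∃ A₁₂ ∈ Set.centralizer {B},
        ∃ A₂₁ ∈ Set.centralizer {B}, ∃ A₂₂ ∈ Set.centralizer {B},
          M = dsum (a • 1) (dsum (b • 1) (dsum (c • 1)
            (dsum (d • 1) (blk A₁₁ A₁₂ A₂₁ A₂₂))))} ∧
    ((pencilGens lam T).centralizer.centralizer).centralizer =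
      {M | ∃ (A₀ : H₀ →L[ℂ] H₀) (A₁ : H₁ →L[ℂ] H₁) (A₂ : H₂ →L[ℂ] H₂) (A₃ : H₃ →L[ℂ] H₃),
        ∃ A ∈ Set.centralizer (Set.centralizer {B}),
          M = dsum A₀ (dsum A₁ (dsum A₂ (dsum A₃ (blk A 0 0 A))))} := by
  subst hT
  rw [Set.centralizer_centralizer_centralizer, centralizer_pencilGens_eq hlam hB₁ hB₂]
  exact ⟨centralizer_dsum_eq B, rfl⟩
end
end

section
/- Let T ∈ B(H) be self-adjoint and suppose T = λP + Q and T = μP₁ + Q₁, where λ, μ ∈ ℝ and P, Q, P₁, Q₁ are nonzero orthogonal projections on H. If μ = 0, then λ ∈ {−1, 0, 1}. -/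
/-- If `R` and `R - c • p` are idempotent for a nonzero idempotent `p`, then `c ∈ {-1, 0, 1}`. -/
theorem coeff_of_sub_smul_isIdempotentElem {K A : Type*} [Field K] [CharZero K] [Ring A]
    [Algebra K A] {c : K} {p r : A} (hp : p * p = p) (hr : r * r = r)
    (hq : (r - c • p) * (r - c • p) = r - c • p) (hne : p ≠ 0) :
    c = -1 ∨ c = 0 ∨ c = 1 := by
  by_cases hc : c = 0
  · exact Or.inr (Or.inl hc)
  have hanti : r * p + p * r = (c + 1) • p := by
    have h : c • (r * p + p * r - (c + 1) • p) = 0 := by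
      simp only [sub_mul, mul_sub, smul_mul_assoc, mul_smul_comm, hp, hr] at hq
      linear_combination (norm := module) -hq
    exact sub_eq_zero.mp ((smul_eq_zero.mp h).resolve_left hc)
  have hcomm : p * r = r * p := by
    have h₁ := congrArg (p * ·) hanti
    have h₂ := congrArg (· * p) hanti
    simp only [mul_add, add_mul, mul_smul_comm, smul_mul_assoc, ← mul_assoc, hp] at h₁ h₂
    rw [mul_assoc r p p, hp] at h₂
    exact add_left_cancel (h₁.trans (h₂.symm.trans (add_comm _ _)))
  have hrp : r * p = ((c + 1) / 2) • p := by
    rw [hcomm] at hanti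
    linear_combination (norm := module) (1 / 2 : K) • hanti
  have h : ((c + 1) / 2 * ((c + 1) / 2) - (c + 1) / 2) • p = 0 := by
    have h : ((c + 1) / 2) • p = ((c + 1) / 2) • ((c + 1) / 2) • p := by
      rw [← hrp, ← mul_smul_comm, ← hrp, ← mul_assoc, hr]
    linear_combination (norm := module) -h
  have h := (smul_eq_zero.mp h).resolve_right hne
  have h : (c + 1) * (c - 1) = 0 := by linear_combination 4 * h
  rcases mul_eq_zero.mp h with h | h
  · exact Or.inl (eq_neg_of_add_eq_zero_left h)
  · exact Or.inr (Or.inr (sub_eq_zero.mp h))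

/-- If a self-adjoint `T` is the pencil `λP + Q` of a pair of nonzero projections and also
`μP₁ + Q₁` with `μ = 0`, then `λ ∈ {−1, 0, 1}`. -/
theorem pencil_at_zero_forces {H : Type*} [NormedAddCommGroup H]
    [InnerProductSpace ℂ H] [CompleteSpace H]
    (T : H →L[ℂ] H) (hTsa : IsSelfAdjoint T) (lam mu : ℝ)
    (P Q P₁ Q₁ : H →L[ℂ] H)
    (hP : IsOrthoProj P) (hQ : IsOrthoProj Q) (hP₁ : IsOrthoProj P₁) (hQ₁ : IsOrthoProj Q₁)
    (hPne : P ≠ 0) (hQne : Q ≠ 0) (hP₁ne : P₁ ≠ 0) (hQ₁ne : Q₁ ≠ 0)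
    (hT : T = (lam : ℂ) • P + Q) (hT₁ : T = (mu : ℂ) • P₁ + Q₁)
    (hmu : mu = 0) :
    lam = -1 ∨ lam = 0 ∨ lam = 1 := by
  have hQeq : Q = Q₁ - (lam : ℂ) • P := by
    rw [eq_sub_iff_add_eq', ← hT, hT₁, hmu]
    simp
  have h := coeff_of_sub_smul_isIdempotentElem hP.2 hQ₁.2 (hQeq ▸ hQ.2) hPne
  exact_mod_cast h
end
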